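/- For q = 2^h, any arc in PG(2,q) contained in a hyperconic, containing the nucleus, and hyperfocused on a line secant to the conic has its non-nucleus points forming a coset structure: after a projective transformation taking the conic to x^2 = yz, the non-nucleus points are {(t : t^2 : 1) : t ∈ S} for S a subgroup of the multiplicative group of GF(q). -/

import Mathlib

open scoped LinearAlgebra.Projectivization

/-- A finite nonempty subset of a commutative group with at most as many pairwise products as
elements is a coset of a subgroup. -/
theorem Finset.exists_subgroup_of_card_mul_self_le {G : Type*} [CommGroup G] [DecidableEq G]
    (A : Finset G) {a : G} (ha : a ∈ A)
    (hA : (Finset.image₂ (· * ·) A A).card ≤ A.card) :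
    ∃ H : Subgroup G, ∀ x, x ∈ H ↔ a * x ∈ A := by
  have key : ∀ b ∈ A, A.image (b * ·) = Finset.image₂ (· * ·) A A := fun b hb =>
    Finset.eq_of_subset_of_card_le
      (fun x hx => by
        obtain ⟨y, hy, rfl⟩ := Finset.mem_image.1 hx
        exact Finset.mem_image₂_of_mem hb hy)
      (hA.trans (Finset.card_image_of_injective A (mul_right_injective b)).ge)
  have shift : ∀ x ∈ A, ∀ y ∈ A, ∀ b ∈ A, b⁻¹ * (x * y) ∈ A := by
    intro x hx y hy b hb
    have h := Finset.mem_image₂_of_mem (f := (· * ·)) hx hy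
    rw [← key b hb] at h
    obtain ⟨z, hz, hzx⟩ := Finset.mem_image.1 h
    rw [← hzx, inv_mul_cancel_left]
    exact hz
  refine ⟨{ carrier := {x | a * x ∈ A}, one_mem' := by simpa using ha, mul_mem' := ?_,
            inv_mem' := ?_ }, fun x => Iff.rfl⟩
  · intro x y hx hy
    have h := shift _ hx _ hy a ha
    have e : a⁻¹ * (a * x * (a * y)) = a * (x * y) := by
      rw [mul_assoc a x, inv_mul_cancel_left, mul_left_comm]
    rwa [e] at h
  · intro x hx
    have h := shift _ ha _ ha _ hx
    have e : (a * x)⁻¹ * (a * a) = a * x⁻¹ := by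
      rw [mul_inv_rev, mul_assoc, inv_mul_cancel_left, mul_comm]
    rwa [e] at h

namespace Projectivization

variable {𝔽 V : Type*} [Field 𝔽] [AddCommGroup V] [Module 𝔽 V]

theorem quadraticForm_rep_mk_eq_zero_iff (Q : QuadraticForm 𝔽 V) {v : V} (hv : v ≠ 0) :
    Q (mk 𝔽 v hv).rep = 0 ↔ Q v = 0 := by
  obtain ⟨a, ha⟩ := exists_smul_eq_mk_rep 𝔽 v hv
  rw [← ha, Units.smul_def, QuadraticMap.map_smul]
  simp

theorem linearMap_rep_mk_eq_zero_iff (f : V →ₗ[𝔽] 𝔽) {v : V} (hv : v ≠ 0) :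
    f (mk 𝔽 v hv).rep = 0 ↔ f v = 0 := by
  obtain ⟨a, ha⟩ := exists_smul_eq_mk_rep 𝔽 v hv
  rw [← ha, Units.smul_def, map_smul]
  simp

theorem eq_of_rep_eq_smul {p q : ℙ 𝔽 V} {a : 𝔽} (h : p.rep = a • q.rep) : p = q := by
  rw [← p.mk_rep, ← q.mk_rep, mk_eq_mk_iff']
  exact ⟨a, h.symm⟩

/-- A line meeting the zero set of a quadratic form in exactly two points meets it in two points
that are not conjugate. -/
theorem exists_polar_ne_zero_of_ncard_eq_two (Q : QuadraticForm 𝔽 V) (φ : V →ₗ[𝔽] 𝔽)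
    (h : {p : ℙ 𝔽 V | Q p.rep = 0 ∧ φ p.rep = 0}.ncard = 2) :
    ∃ x y : V, Q x = 0 ∧ φ x = 0 ∧ Q y = 0 ∧ φ y = 0 ∧ QuadraticMap.polar Q x y ≠ 0 := by
  obtain ⟨p, q, hpq, hs⟩ := Set.ncard_eq_two.1 h
  have hp : p ∈ ({p : ℙ 𝔽 V | Q p.rep = 0 ∧ φ p.rep = 0} : Set _) := by rw [hs]; simp
  have hq : q ∈ ({p : ℙ 𝔽 V | Q p.rep = 0 ∧ φ p.rep = 0} : Set _) := by rw [hs]; simp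
  refine ⟨p.rep, q.rep, hp.1, hp.2, hq.1, hq.2, fun h0 => ?_⟩
  have hne : p.rep + q.rep ≠ 0 := fun h0 => hpq <| eq_of_rep_eq_smul (a := -1) <| by
    rw [neg_one_smul]; exact eq_neg_of_add_eq_zero_left h0
  have hmem : mk 𝔽 (p.rep + q.rep) hne ∈
      ({p : ℙ 𝔽 V | Q p.rep = 0 ∧ φ p.rep = 0} : Set _) := by
    refine ⟨(quadraticForm_rep_mk_eq_zero_iff Q hne).2 ?_,
      (linearMap_rep_mk_eq_zero_iff φ hne).2 ?_⟩
    · rw [QuadraticMap.map_add Q, hp.1, hq.1, h0]; simp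
    · rw [map_add, hp.2, hq.2, add_zero]
  rw [hs] at hmem
  rcases hmem with h1 | h1
  · obtain ⟨a, ha⟩ := (mk_eq_mk_iff' 𝔽 _ _ hne p.rep_nonzero).1 (h1.trans p.mk_rep.symm)
    refine hpq.symm (eq_of_rep_eq_smul (a := a - 1) ?_)
    rw [sub_smul, ha]; simp
  · obtain ⟨a, ha⟩ := (mk_eq_mk_iff' 𝔽 _ _ hne q.rep_nonzero).1
      ((Set.mem_singleton_iff.1 h1).trans q.mk_rep.symm)
    refine hpq (eq_of_rep_eq_smul (a := a - 1) ?_)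
    rw [sub_smul, ha]; simp

end Projectivization

section NormalForm

variable {𝔽 : Type*} [Field 𝔽]

/-- An irreducible ternary quadratic form together with a secant line
is, up to a scalar, `x² + y z` together with the line `x = 0` in suitable coordinates. -/
theorem QuadraticForm.exists_linearEquiv_eq_sq_add_mul (Q : QuadraticForm 𝔽 (Fin 3 → 𝔽))
    (hQirr : ¬∃ f g : (Fin 3 → 𝔽) →ₗ[𝔽] 𝔽, ∀ x, Q x = f x * g x)
    (φ : (Fin 3 → 𝔽) →ₗ[𝔽] 𝔽) (hφ : φ ≠ 0) {x y : Fin 3 → 𝔽}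
    (hQx : Q x = 0) (hφx : φ x = 0) (hQy : Q y = 0) (hφy : φ y = 0)
    (hxy : QuadraticMap.polar Q x y ≠ 0) :
    ∃ (g : (Fin 3 → 𝔽) ≃ₗ[𝔽] (Fin 3 → 𝔽)) (k : 𝔽), k ≠ 0 ∧
      (∀ v, Q v = k * (g v 0 ^ 2 + g v 1 * g v 2)) ∧ ∀ v, φ v = g v 0 := by
  set m := QuadraticMap.polar Q x y with hm
  set B := QuadraticMap.polarBilin Q
  have hBp : ∀ u v, B u v = QuadraticMap.polar Q u v := fun u v => rfl
  have hyx : B y x = m := by rw [hBp, QuadraticMap.polar_comm]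
  have hxx : B x x = 0 := by rw [hBp, QuadraticMap.polar_self, hQx, smul_zero]
  have hyy : B y y = 0 := by rw [hBp, QuadraticMap.polar_self, hQy, smul_zero]
  have hxy' : B x y = m := rfl
  obtain ⟨w, hw⟩ : ∃ w, φ w = 1 := by
    obtain ⟨w, hw⟩ := DFunLike.ne_iff.1 hφ
    exact ⟨(φ w)⁻¹ • w, by rw [map_smul, smul_eq_mul, inv_mul_cancel₀ hw]⟩
  obtain ⟨z, hz, hxz, hyz⟩ : ∃ z, φ z = 1 ∧ B x z = 0 ∧ B y z = 0 := by
    refine ⟨w - (m⁻¹ * B y w) • x - (m⁻¹ * B x w) • y, ?_, ?_, ?_⟩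
    · simp [hφx, hφy, hw]
    · simp only [map_sub, map_smul, smul_eq_mul, hxx, hxy']
      field_simp
      ring
    · simp only [map_sub, map_smul, smul_eq_mul, hyy, hyx]
      field_simp
      ring
  have hQlin : ∀ a b c : 𝔽, Q (c • z + a • x + b • y) = c ^ 2 * Q z + m * (a * b) := by
    intro a b c
    have hzx : QuadraticMap.polar Q z x = 0 := by rw [QuadraticMap.polar_comm]; exact hxz
    have hzy : QuadraticMap.polar Q z y = 0 := by rw [QuadraticMap.polar_comm]; exact hyz
    rw [QuadraticMap.map_add Q, QuadraticMap.map_add Q, QuadraticMap.polar_add_left]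
    simp only [QuadraticMap.map_smul, QuadraticMap.polar_smul_left,
      QuadraticMap.polar_smul_right, hQx, hQy, hzx, hzy, ← hm, smul_eq_mul]
    ring
  let f (r s : 𝔽) : (Fin 3 → 𝔽) →ₗ[𝔽] (Fin 3 → 𝔽) := LinearMap.pi ![φ, r • B y, s • B x]
  have f0 : ∀ r s v, f r s v 0 = φ v := fun _ _ _ => rfl
  have f1 : ∀ r s v, f r s v 1 = r * B y v := fun _ _ _ => rfl
  have f2 : ∀ r s v, f r s v 2 = s * B x v := fun _ _ _ => rfl
  have hsurj : ∀ r s, r ≠ 0 → s ≠ 0 → Function.Surjective (f r s) := by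
    intro r s hr hs u
    refine ⟨u 0 • z + (r⁻¹ * m⁻¹ * u 1) • x + (s⁻¹ * m⁻¹ * u 2) • y, ?_⟩
    ext i
    fin_cases i
    · simp [f0, hz, hφx, hφy]
    · simp only [Fin.mk_one, f1, map_add, map_smul, hyz, hyx, hyy, smul_eq_mul]
      field_simp
      ring
    · simp only [Fin.reduceFinMk, f2, map_add, map_smul, hxz, hxy', hxx, smul_eq_mul]
      field_simp
      ring
  have hinj : ∀ r s, r ≠ 0 → s ≠ 0 → Function.Injective (f r s) := fun r s hr hs =>
    LinearMap.injective_iff_surjective.2 (hsurj r s hr hs)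
  have hdec : ∀ v, v = φ v • z + (m⁻¹ * B y v) • x + (m⁻¹ * B x v) • y := by
    intro v
    apply hinj 1 1 one_ne_zero one_ne_zero
    ext i
    fin_cases i
    · simp [f0, hz, hφx, hφy]
    · simp only [Fin.mk_one, f1, map_add, map_smul, hyz, hyx, hyy, smul_eq_mul]
      field_simp
      ring
    · simp only [Fin.reduceFinMk, f2, map_add, map_smul, hxz, hxy', hxx, smul_eq_mul]
      field_simp
      ring
  have hQv : ∀ v, Q v = φ v ^ 2 * Q z + m⁻¹ * (B y v * B x v) := by
    intro v
    conv_lhs => rw [hdec v, hQlin]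
    field_simp
  have hn : Q z ≠ 0 := by
    intro hn
    refine hQirr ⟨m⁻¹ • B y, B x, fun v => ?_⟩
    rw [hQv v, hn, LinearMap.smul_apply, smul_eq_mul]
    ring
  have hr : m⁻¹ * (Q z)⁻¹ ≠ 0 := mul_ne_zero (inv_ne_zero hxy) (inv_ne_zero hn)
  refine ⟨LinearEquiv.ofBijective (f (m⁻¹ * (Q z)⁻¹) 1)
    ⟨hinj _ _ hr one_ne_zero, hsurj _ _ hr one_ne_zero⟩, Q z, hn, fun v => ?_, fun v => rfl⟩
  rw [hQv v]
  change _ = Q z * (φ v ^ 2 + m⁻¹ * (Q z)⁻¹ * B y v * (1 * B x v))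
  field_simp

/-- A point on every tangent line of the conic `x² + y z = 0` is the point `(1 : 0 : 0)`. -/
theorem nucleus_coordinates_eq_zero (Q : QuadraticForm 𝔽 (Fin 3 → 𝔽))
    (N : ℙ 𝔽 (Fin 3 → 𝔽))
    (hNuc : ∀ ψ : (Fin 3 → 𝔽) →ₗ[𝔽] 𝔽, ψ ≠ 0 →
      (∃ p : ℙ 𝔽 (Fin 3 → 𝔽), Q p.rep = 0 ∧ ψ p.rep = 0 ∧
        ∀ q : ℙ 𝔽 (Fin 3 → 𝔽), Q q.rep = 0 → ψ q.rep = 0 → q = p) →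
      ψ N.rep = 0)
    (g : (Fin 3 → 𝔽) ≃ₗ[𝔽] (Fin 3 → 𝔽)) {k : 𝔽} (hk : k ≠ 0)
    (hQ : ∀ v, Q v = k * (g v 0 ^ 2 + g v 1 * g v 2)) :
    g N.rep 1 = 0 ∧ g N.rep 2 = 0 := by
  have key : ∀ i j : Fin 3, i ≠ 0 → j ≠ 0 → i ≠ j →
      (∀ v, Q v = k * (g v 0 ^ 2 + g v i * g v j)) → g N.rep i = 0 := by
    intro i j hi hj hij hQ
    have hv : g.symm (Pi.single j 1) ≠ 0 := by simp
    have hw : g (g.symm (Pi.single i 1)) i = 1 := by simp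
    refine hNuc ((LinearMap.proj i).comp g.toLinearMap) (fun h => ?_)
      ⟨Projectivization.mk 𝔽 (g.symm (Pi.single j 1)) hv, ?_, ?_, ?_⟩
    · have h' : g (g.symm (Pi.single i 1)) i = 0 := LinearMap.congr_fun h _
      exact one_ne_zero (hw.symm.trans h')
    · rw [Projectivization.quadraticForm_rep_mk_eq_zero_iff, hQ]
      simp [hj.symm, hij]
    · rw [Projectivization.linearMap_rep_mk_eq_zero_iff]
      simp [hij]
    · intro q hq hqi
      have hqi' : g q.rep i = 0 := hqi
      have hq0 : g q.rep 0 = 0 := by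
        rw [hQ, hqi'] at hq
        simpa [hk] using hq
      rw [← q.mk_rep, Projectivization.mk_eq_mk_iff']
      refine ⟨g q.rep j, g.injective ?_⟩
      rw [map_smul, LinearEquiv.apply_symm_apply]
      ext l
      by_cases hlj : l = j
      · subst hlj; simp
      · have : l = 0 ∨ l = i := by omega
        rcases this with rfl | rfl <;> simp [hlj, hq0, hqi']
  exact ⟨key 1 2 (by decide) (by decide) (by decide) hQ,
    key 2 1 (by decide) (by decide) (by decide) fun v => by rw [hQ, mul_comm (g v 1)]⟩

end NormalForm

theorem hyperfocused_on_secant_subgroup {𝔽 : Type*} [Field 𝔽] [Fintype 𝔽] [CharP 𝔽 2]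
    -- the conic: zero set of a nonzero irreducible quadratic form
    (Q : QuadraticForm 𝔽 (Fin 3 → 𝔽)) (hQ0 : Q ≠ 0)
    (hQirr : ¬∃ f g : (Fin 3 → 𝔽) →ₗ[𝔽] 𝔽, ∀ x, Q x = f x * g x)
    -- the nucleus: every tangent line to the conic passes through N
    (N : ℙ 𝔽 (Fin 3 → 𝔽))
    (hNuc : ∀ ψ : (Fin 3 → 𝔽) →ₗ[𝔽] 𝔽, ψ ≠ 0 →
      (∃ p : ℙ 𝔽 (Fin 3 → 𝔽), Q p.rep = 0 ∧ ψ p.rep = 0 ∧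
        ∀ q : ℙ 𝔽 (Fin 3 → 𝔽), Q q.rep = 0 → ψ q.rep = 0 → q = p) →
      ψ N.rep = 0)
    -- the arc K on the hyperconic, containing the nucleus
    (K : Finset (ℙ 𝔽 (Fin 3 → 𝔽))) (hK : 4 < K.card) (hNK : N ∈ K)
    (hsub : ∀ p ∈ K, p = N ∨ Q p.rep = 0)
    -- the focus line, secant to the conic and missing K
    (φ : (Fin 3 → 𝔽) →ₗ[𝔽] 𝔽) (hφ : φ ≠ 0)
    (hsecant : {p : ℙ 𝔽 (Fin 3 → 𝔽) | Q p.rep = 0 ∧ φ p.rep = 0}.ncard = 2)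
    (hmiss : ∀ p ∈ K, φ p.rep ≠ 0)
    -- K is hyperfocused on the line: secants of K meet it in exactly |K| - 1 points
    (hfocus : {x : ℙ 𝔽 (Fin 3 → 𝔽) | φ x.rep = 0 ∧ ∃ p ∈ K, ∃ q ∈ K, p ≠ q ∧
      x.rep ∈ Submodule.span 𝔽 {Projectivization.rep p, Projectivization.rep q}}.ncard
        = K.card - 1) :
    -- conclusion: after a projective transformation, K \ {N} is the set of conic points
    -- (t : t² : 1) with t ranging over a subgroup of 𝔽*
    ∃ (g : (Fin 3 → 𝔽) →ₗ[𝔽] (Fin 3 → 𝔽)) (hg : Function.Injective g)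
      (S : Subgroup 𝔽ˣ),
      Projectivization.map g hg '' ((K : Set (ℙ 𝔽 (Fin 3 → 𝔽))) \ {N}) =
        {p : ℙ 𝔽 (Fin 3 → 𝔽) | ∃ t : 𝔽ˣ, t ∈ S ∧
          p = Projectivization.mk 𝔽 ![(t : 𝔽), (t : 𝔽) ^ 2, 1]
            (fun h => one_ne_zero (α := 𝔽) (congrFun h 2))} := by
  classical
  obtain ⟨x, y, hQx, hφx, hQy, hφy, hxy⟩ :=
    Projectivization.exists_polar_ne_zero_of_ncard_eq_two Q φ hsecant
  obtain ⟨g, k, hk, hQ, hφg⟩ :=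
    Q.exists_linearEquiv_eq_sq_add_mul hQirr φ hφ hQx hφx hQy hφy hxy
  obtain ⟨hN1, hN2⟩ := nucleus_coordinates_eq_zero Q N hNuc g hk hQ
  have hparam : ∀ p ∈ K.erase N, ∃ t : 𝔽ˣ, g p.rep 2 ≠ 0 ∧ g p.rep 0 = t * g p.rep 2 ∧
      g p.rep 1 = (t : 𝔽) ^ 2 * g p.rep 2 := by
    intro p hp
    obtain ⟨hpN, hpK⟩ := Finset.mem_erase.1 hp
    have hp0 : g p.rep 0 ≠ 0 := by rw [← hφg]; exact hmiss p hpK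
    have hpQ : g p.rep 0 ^ 2 + g p.rep 1 * g p.rep 2 = 0 := by
      have h := (hsub p hpK).resolve_left hpN
      rw [hQ] at h
      exact (mul_eq_zero.1 h).resolve_left hk
    rw [CharTwo.add_eq_zero] at hpQ
    have hp2 : g p.rep 2 ≠ 0 := fun h => by
      rw [h, mul_zero] at hpQ
      exact hp0 (pow_eq_zero_iff two_ne_zero |>.1 hpQ)
    refine ⟨Units.mk0 (g p.rep 0 / g p.rep 2) (div_ne_zero hp0 hp2), hp2, ?_, ?_⟩
    · rw [Units.val_mk0, div_mul_cancel₀ _ hp2]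
    · rw [Units.val_mk0, div_pow, hpQ]
      field_simp
  choose! t ht2 ht0 ht1 using hparam
  have htinj : Set.InjOn t (K.erase N) := by
    intro p hp q hq hpq
    have hp' := Finset.mem_coe.1 hp
    have hq' := Finset.mem_coe.1 hq
    apply Projectivization.eq_of_rep_eq_smul (a := g p.rep 2 / g q.rep 2)
    apply g.injective
    rw [map_smul]
    have hq2 := ht2 q hq'
    ext i
    fin_cases i
    · simp only [Fin.zero_eta, Pi.smul_apply, smul_eq_mul, ht0 p hp', ht0 q hq', hpq]
      field_simp
    · simp only [Fin.mk_one, Pi.smul_apply, smul_eq_mul, ht1 p hp', ht1 q hq', hpq]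
      field_simp
    · simp only [Fin.reduceFinMk, Pi.smul_apply, smul_eq_mul]
      field_simp
  have hv : ∀ u : 𝔽, g.symm ![0, u, 1] ≠ 0 := fun u h => by
    have h' := congrFun ((LinearEquiv.symm_apply_eq g).1 h) 2
    simp at h'
  have hcard : (Finset.image₂ (· * ·) ((K.erase N).image t) ((K.erase N).image t)).card ≤
      ((K.erase N).image t).card := by
    rw [Finset.card_image_of_injOn htinj, Finset.card_erase_of_mem hNK, ← hfocus,
      ← Set.ncard_coe_finset]
    refine Set.ncard_le_ncard_of_injOn
      (fun u : 𝔽ˣ => Projectivization.mk 𝔽 (g.symm ![0, (u : 𝔽), 1]) (hv u)) ?_ ?_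
      (Set.toFinite _)
    · intro u hu
      obtain ⟨_, hs, _, hs', rfl⟩ := Finset.mem_image₂.1 (Finset.mem_coe.1 hu)
      obtain ⟨p, hp, rfl⟩ := Finset.mem_image.1 hs
      obtain ⟨q, hq, rfl⟩ := Finset.mem_image.1 hs'
      refine ⟨?_, ?_⟩
      · rw [Projectivization.linearMap_rep_mk_eq_zero_iff, hφg]
        simp
      obtain ⟨a, ha⟩ := Projectivization.exists_smul_eq_mk_rep 𝔽 _ (hv ((t p * t q : 𝔽ˣ) : 𝔽))
      have hp2 := ht2 p hp
      have hq2 := ht2 q hq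
      by_cases hpq : p = q
      · subst hpq
        refine ⟨N, hNK, p, Finset.mem_of_mem_erase hp, (Finset.ne_of_mem_erase hp).symm, ?_⟩
        have hN0 : g N.rep 0 ≠ 0 := by rw [← hφg]; exact hmiss N hNK
        rw [← ha, Units.smul_def]
        refine Submodule.smul_mem _ _ (Submodule.mem_span_pair.2
          ⟨- (t p : 𝔽) / g N.rep 0, 1 / g p.rep 2, ?_⟩)
        apply g.injective
        rw [map_add, map_smul, map_smul, LinearEquiv.apply_symm_apply]
        ext i
        fin_cases i
        · simp only [Fin.zero_eta, Pi.add_apply, Pi.smul_apply, smul_eq_mul, ht0 p hp,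
            Matrix.cons_val_zero]
          field_simp
          ring
        · simp only [Fin.mk_one, Pi.add_apply, Pi.smul_apply, smul_eq_mul, ht1 p hp, hN1,
            Matrix.cons_val_one, Matrix.cons_val_zero, Units.val_mul]
          field_simp
          ring
        · simp only [Fin.reduceFinMk, Pi.add_apply, Pi.smul_apply, smul_eq_mul, hN2,
            Matrix.cons_val]
          field_simp
          ring
      · refine ⟨p, Finset.mem_of_mem_erase hp, q, Finset.mem_of_mem_erase hq, hpq, ?_⟩
        have hd : (t p : 𝔽) - t q ≠ 0 := fun h =>
          hpq (htinj (Finset.mem_coe.2 hp) (Finset.mem_coe.2 hq) (Units.ext (sub_eq_zero.1 h)))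
        have h2 : (2 : 𝔽) = 0 := CharTwo.two_eq_zero
        rw [← ha, Units.smul_def]
        refine Submodule.smul_mem _ _ (Submodule.mem_span_pair.2
          ⟨t q / (g p.rep 2 * (t p - t q)), - t p / (g q.rep 2 * (t p - t q)), ?_⟩)
        apply g.injective
        rw [map_add, map_smul, map_smul, LinearEquiv.apply_symm_apply]
        ext i
        fin_cases i
        · simp only [Fin.zero_eta, Pi.add_apply, Pi.smul_apply, smul_eq_mul, ht0 p hp, ht0 q hq,
            Matrix.cons_val_zero]
          field_simp
          ring
        · simp only [Fin.mk_one, Pi.add_apply, Pi.smul_apply, smul_eq_mul, ht1 p hp, ht1 q hq,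
            Matrix.cons_val_one, Matrix.cons_val_zero, Units.val_mul]
          field_simp
          ring
        · simp only [Fin.reduceFinMk, Pi.add_apply, Pi.smul_apply, smul_eq_mul,
            Matrix.cons_val]
          field_simp
          linear_combination (t q - t p : 𝔽) * h2
    · intro u _ u' _ h
      obtain ⟨a, ha⟩ := (Projectivization.mk_eq_mk_iff' _ _ _ _ _).1 h
      rw [← map_smul] at ha
      have ha' := g.symm.injective ha
      have h2 := congrFun ha' 2
      have h1 := congrFun ha' 1
      simp only [Pi.smul_apply, smul_eq_mul, Matrix.cons_val, mul_one] at h1 h2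
      exact Units.ext (by rw [← h1, h2, one_mul])
  obtain ⟨a, ha⟩ : ((K.erase N).image t).Nonempty := by
    rw [Finset.image_nonempty, ← Finset.card_pos, Finset.card_erase_of_mem hNK]
    omega
  obtain ⟨H, hH⟩ := Finset.exists_subgroup_of_card_mul_self_le _ ha hcard
  let d : (Fin 3 → 𝔽) →ₗ[𝔽] (Fin 3 → 𝔽) := LinearMap.pi
    ![(a : 𝔽)⁻¹ • LinearMap.proj 0, ((a : 𝔽)⁻¹) ^ 2 • LinearMap.proj 1, LinearMap.proj 2]
  have d0 : ∀ v, d v 0 = (a : 𝔽)⁻¹ * v 0 := fun _ => rfl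
  have d1 : ∀ v, d v 1 = (a : 𝔽)⁻¹ ^ 2 * v 1 := fun _ => rfl
  have d2 : ∀ v, d v 2 = v 2 := fun _ => rfl
  have hd : Function.Injective d := by
    rw [injective_iff_map_eq_zero]
    intro v hv
    have h0 := congrFun hv 0
    have h1 := congrFun hv 1
    have h2 := congrFun hv 2
    rw [d0] at h0
    rw [d1] at h1
    rw [d2] at h2
    ext i
    fin_cases i
    · simpa using h0
    · simpa using h1
    · exact h2
  have hmap : ∀ p ∈ K.erase N, ∀ s : 𝔽ˣ, t p = a * s →
      Projectivization.map (d.comp g.toLinearMap) (hd.comp g.injective) p =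
        Projectivization.mk 𝔽 ![(s : 𝔽), (s : 𝔽) ^ 2, 1]
          (fun h => one_ne_zero (α := 𝔽) (congrFun h 2)) := by
    intro p hp s hs
    conv_lhs => rw [← p.mk_rep]
    rw [Projectivization.map_mk, Projectivization.mk_eq_mk_iff']
    have hs' : (t p : 𝔽) = a * s := by rw [hs, Units.val_mul]
    have ha0 := a.ne_zero
    refine ⟨g p.rep 2, ?_⟩
    ext i
    fin_cases i
    · change g p.rep 2 * s = (a : 𝔽)⁻¹ * g p.rep 0
      rw [ht0 p hp, hs']
      field_simp
    · change g p.rep 2 * (s : 𝔽) ^ 2 = (a : 𝔽)⁻¹ ^ 2 * g p.rep 1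
      rw [ht1 p hp, hs']
      field_simp
    · change g p.rep 2 * 1 = g p.rep 2
      rw [mul_one]
  refine ⟨d.comp g.toLinearMap, hd.comp g.injective, H, ?_⟩
  rw [← Finset.coe_erase]
  ext z
  constructor
  · rintro ⟨p, hp, rfl⟩
    have hp' := Finset.mem_coe.1 hp
    refine ⟨a⁻¹ * t p, (hH _).2 ?_, hmap p hp' _ (mul_inv_cancel_left a _).symm⟩
    rw [mul_inv_cancel_left]
    exact Finset.mem_image_of_mem t hp'
  · rintro ⟨s, hs, rfl⟩
    obtain ⟨p, hp, hps⟩ := Finset.mem_image.1 ((hH s).1 hs)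
    exact ⟨p, Finset.mem_coe.2 hp, hmap p hp s hps⟩
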